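/- arXiv:1209.4847 — 5 statements merged into one kernel-verified Lean document; each statement's English description precedes it below -/
import Mathlib

section
/- The splicing (n+m+1)-groupoid GA(n+m+1; a,…,a,b,…,b) (with n+1 coordinate ranges equal to a followed by m+1 coordinate ranges equal to b) is isomorphic to the genetic product GA(n,a) *_G GA(m,b): under the natural bijection between Π k : Fin (n+m+2), Fin (d k + 1) (where d k = a for (k : ℕ) ≤ n and d k = b otherwise) and (Fin (n+1) → Fin (a+1)) × (Fin (m+1) → Fin (b+1)) splitting each tuple into its first n+1 and last m+1 coordinates, the splicing operation ×_i corresponds to: the first-kind operation induced by the splicing operation ×_i of GA(n,a) when (i : ℕ) ≤ n−1; the middle operation when (i : ℕ) = n; and the second-kind operation induced by the splicing operation ×_{i−n−1} of GA(m,b) when (i : ℕ) ≥ n+1. -/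
/-- The splicing operation `×ᵢ` on the solution space `Π k : Fin (n+1), Fin (d k + 1)`:
`(a ×ᵢ b) k = a k` if `(k : ℕ) ≤ (i : ℕ)` and `b k` otherwise. -/
def splice (n : ℕ) (d : Fin (n + 1) → ℕ) (i : Fin n)
    (a b : ∀ k : Fin (n + 1), Fin (d k + 1)) : ∀ k : Fin (n + 1), Fin (d k + 1) :=
  fun k => if (k : ℕ) ≤ (i : ℕ) then a k else b k

/-- Coordinate ranges for `GA(n+m+1; a,…,a,b,…,b)`: `a` for the first `n+1` coordinates
and `b` for the remaining `m+1` coordinates. -/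
def dSplit (n m a b : ℕ) : Fin (n + m + 2) → ℕ := fun k => if (k : ℕ) ≤ n then a else b

/-- The natural bijection splitting a tuple into its first `n+1` and last `m+1` coordinates. -/
def splitE (n m a b : ℕ) (t : ∀ k : Fin (n + m + 2), Fin (dSplit n m a b k + 1)) :
    (Fin (n + 1) → Fin (a + 1)) × (Fin (m + 1) → Fin (b + 1)) :=
  (fun k => Fin.cast (by have := k.is_le; simp [dSplit, this]) (t ⟨k, by omega⟩),
   fun k => Fin.cast (by have h : ¬ ((n + 1 + (k : ℕ)) ≤ n) := (by omega); simp [dSplit, h])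
     (t ⟨n + 1 + (k : ℕ), by omega⟩))

/-- `GA(n+m+1; a,…,a,b,…,b) ≅ GA(n,a) *_G GA(m,b)`: under the splitting bijection, the
splicing operation `×ᵢ` corresponds to the first-kind operation induced by `×ᵢ` of `GA(n,a)`
when `i ≤ n−1`, to the middle operation when `i = n`, and to the second-kind operation
induced by `×_{i−n−1}` of `GA(m,b)` when `i ≥ n+1`. -/
theorem splicing_groupoid_genetic_product (n m a b : ℕ) (hn : 1 ≤ n) (hm : 1 ≤ m) :
    Function.Bijective (splitE n m a b) ∧
    ∀ (i : Fin (n + m + 1)) (s t : ∀ k : Fin (n + m + 2), Fin (dSplit n m a b k + 1)),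
      (∀ h : (i : ℕ) < n,
        splitE n m a b (splice (n + m + 1) (dSplit n m a b) i s t) =
          (splice n (fun _ => a) ⟨(i : ℕ), h⟩ (splitE n m a b s).1 (splitE n m a b t).1,
            (splitE n m a b t).2)) ∧
      ((i : ℕ) = n →
        splitE n m a b (splice (n + m + 1) (dSplit n m a b) i s t) =
          ((splitE n m a b s).1, (splitE n m a b t).2)) ∧
      (∀ _ : n + 1 ≤ (i : ℕ),
        splitE n m a b (splice (n + m + 1) (dSplit n m a b) i s t) =
          ((splitE n m a b s).1,
            splice m (fun _ => b) ⟨(i : ℕ) - (n + 1), by have := i.isLt; omega⟩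
              (splitE n m a b s).2 (splitE n m a b t).2)) := by
  refine ⟨⟨?_, ?_⟩, ?_⟩
  · intro s t h
    have h1 := congrArg Prod.fst h
    have h2 := congrArg Prod.snd h
    have hb : ∀ j : Fin (m + 1), n + 1 + (j : ℕ) < n + m + 2 := fun j => by omega
    funext k
    by_cases hk : (k : ℕ) ≤ n
    · have := congrFun h1 ⟨k, by omega⟩
      exact Fin.cast_injective (by simp [dSplit, hk]) this
    · obtain ⟨j, hj⟩ : ∃ j : Fin (m + 1), k = ⟨n + 1 + (j : ℕ), hb j⟩ :=
        ⟨⟨k - (n + 1), by omega⟩, by ext; simp; omega⟩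
      subst hj
      have := congrFun h2 j
      exact Fin.cast_injective (by simp only [dSplit, if_neg hk]) this
  · rintro ⟨u, v⟩
    refine ⟨fun k => if hk : (k : ℕ) ≤ n then
      Fin.cast (by simp [dSplit, hk]) (u ⟨k, by omega⟩)
      else Fin.cast (by simp [dSplit, hk]) (v ⟨k - (n + 1), by omega⟩), ?_⟩
    refine Prod.ext (funext fun k => ?_) (funext fun k => ?_)
    · have hk : (k : ℕ) ≤ n := k.is_le
      simp [splitE, hk]
    · have hk : ¬ (n + 1 + (k : ℕ) ≤ n) := by omega
      simp [splitE, hk]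
  · intro i s t
    refine ⟨fun h => ?_, fun h => ?_, fun h => ?_⟩
    · refine Prod.ext (funext fun k => ?_) (funext fun k => ?_)
      · by_cases hk : (k : ℕ) ≤ i <;> simp [splitE, splice, hk]
      · have hk : ¬ (n + 1 + (k : ℕ) ≤ i) := by omega
        simp [splitE, splice, hk]
    · refine Prod.ext (funext fun k => ?_) (funext fun k => ?_)
      · have hk : (k : ℕ) ≤ i := by omega
        simp [splitE, splice, hk]
      · have hk : ¬ (n + 1 + (k : ℕ) ≤ i) := by omega
        simp [splitE, splice, hk]
    · refine Prod.ext (funext fun k => ?_) (funext fun k => ?_)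
      · have hk : (k : ℕ) ≤ i := by omega
        simp [splitE, splice, hk]
      · by_cases hk : n + 1 + (k : ℕ) ≤ i
        · have hk2 : (k : ℕ) ≤ i - (n + 1) := by omega
          simp [splitE, splice, hk, hk2]
        · have hk2 : ¬ ((k : ℕ) ≤ i - (n + 1)) := by omega
          simp [splitE, splice, hk, hk2]
end

section
/- Every automorphism of a genetic product decomposes into automorphisms of the factors: let A, B be nonempty types with binary operations · : A → A → A and * : B → B → B, and let Φ : A × B → A × B be a bijection preserving each of the three operations ∘₁, ∘₂, ∘₃ of the genetic product A *_G B. Then there exist bijections φ : A → A and ψ : B → B with φ(a·c) = φ(a)·φ(c) for all a, c ∈ A and ψ(b*d) = ψ(b)*ψ(d) for all b, d ∈ B, such that Φ(a,b) = (φ(a), ψ(b)) for all (a,b) ∈ A × B. -/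
/-- First-kind operation of the genetic product: `(a,b) ∘₁ (c,d) = (a·c, d)`. -/
def gOp1 {A B : Type*} (mul : A → A → A) : A × B → A × B → A × B :=
  fun p q => (mul p.1 q.1, q.2)

/-- Middle operation of the genetic product: `(a,b) ∘₂ (c,d) = (a, d)`. -/
def gOp2 {A B : Type*} : A × B → A × B → A × B :=
  fun p q => (p.1, q.2)

/-- Second-kind operation of the genetic product: `(a,b) ∘₃ (c,d) = (a, b*d)`. -/
def gOp3 {A B : Type*} (star : B → B → B) : A × B → A × B → A × B :=
  fun p q => (p.1, star p.2 q.2)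

/-- Every automorphism of a genetic product decomposes into automorphisms of the factors. -/
theorem automorphism_decomposition {A B : Type*} [Nonempty A] [Nonempty B]
    (mul : A → A → A) (star : B → B → B) (Φ : A × B → A × B)
    (hbij : Function.Bijective Φ)
    (h1 : ∀ p q, Φ (gOp1 mul p q) = gOp1 mul (Φ p) (Φ q))
    (h2 : ∀ p q, Φ (gOp2 p q) = gOp2 (Φ p) (Φ q))
    (h3 : ∀ p q, Φ (gOp3 star p q) = gOp3 star (Φ p) (Φ q)) :
    ∃ (φ : A → A) (ψ : B → B),
      Function.Bijective φ ∧ Function.Bijective ψ ∧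
      (∀ a c, φ (mul a c) = mul (φ a) (φ c)) ∧
      (∀ b d, ψ (star b d) = star (ψ b) (ψ d)) ∧
      (∀ p : A × B, Φ p = (φ p.1, ψ p.2)) := by
  obtain ⟨a0⟩ := ‹Nonempty A›
  obtain ⟨b0⟩ := ‹Nonempty B›
  have key : ∀ p : A × B, Φ p = ((Φ (p.1, b0)).1, (Φ (a0, p.2)).2) := by
    intro p
    exact h2 (p.1, b0) (a0, p.2)
  refine ⟨fun a => (Φ (a, b0)).1, fun b => (Φ (a0, b)).2, ⟨?_, ?_⟩, ⟨?_, ?_⟩, ?_, ?_, key⟩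
  · intro a c h
    have : Φ (a, b0) = Φ (c, b0) := by
      rw [key (a, b0), key (c, b0)]
      exact Prod.ext h rfl
    exact congrArg Prod.fst (hbij.1 this)
  · intro a
    obtain ⟨p, hp⟩ := hbij.2 (a, b0)
    rw [key p] at hp
    exact ⟨p.1, congrArg Prod.fst hp⟩
  · intro b d h
    have : Φ (a0, b) = Φ (a0, d) := by
      rw [key (a0, b), key (a0, d)]
      exact Prod.ext rfl h
    exact congrArg Prod.snd (hbij.1 this)
  · intro b
    obtain ⟨p, hp⟩ := hbij.2 (a0, b)
    rw [key p] at hp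
    exact ⟨p.2, congrArg Prod.snd hp⟩
  · intro a c
    exact congrArg Prod.fst (h1 (a, b0) (c, b0))
  · intro b d
    exact congrArg Prod.snd (h3 (a0, b) (a0, d))
end

section
/- Theorem 1 (case of two factors): let A and B be finite nonempty semigroups whose multiplications are idempotent and nowhere commutative. Then the genetic product A *_G B is isomorphic to a splicing 3-groupoid GA(3; d₁, d₂, d₃, d₄): there exist natural numbers d₁, d₂, d₃, d₄ and a bijection from A × B to Π k : Fin 4, Fin (d k + 1) carrying the three genetic-product operations ∘₁, ∘₂, ∘₃ respectively to the splicing operations ×_0, ×_1, ×_2. -/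
theorem rect_aux {A : Type*} [Fintype A] [Nonempty A] (mul : A → A → A)
    (hma : ∀ a b c, mul (mul a b) c = mul a (mul b c))
    (hmi : ∀ a, mul a a = a)
    (hmn : ∀ a b, mul a b = mul b a → a = b) :
    ∃ (m n : ℕ) (e : A ≃ Fin (m + 1) × Fin (n + 1)),
      ∀ a b, e (mul a b) = ((e a).1, (e b).2) := by
  classical
  have aba : ∀ a b, mul a (mul b a) = a := by
    intro a b
    symm
    apply hmn
    rw [← hma a a, hmi, hma, hma, hmi]
  have abc : ∀ a b c, mul a (mul b c) = mul a c := by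
    intro a b c
    have h1 : mul (mul a (mul (mul b c) a)) c = mul a c := by rw [aba]
    rw [← h1]
    simp only [hma]
    rw [aba]
  obtain ⟨x⟩ := ‹Nonempty A›
  let L := {l : A // mul l x = l}
  let R := {r : A // mul x r = r}
  let f : A ≃ L × R :=
    { toFun := fun a => (⟨mul a x, by rw [hma, hmi]⟩, ⟨mul x a, by rw [← hma, hmi]⟩)
      invFun := fun p => mul p.1.1 p.2.1
      left_inv := fun a => by simp only [hma, abc, hmi]
      right_inv := by
        rintro ⟨⟨l, hl⟩, ⟨r, hr⟩⟩
        ext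
        · simp only [hma, abc, hl]
        · simp only [abc, hr] }
  have hL : Fintype.card L = (Fintype.card L - 1) + 1 := by
    have : 0 < Fintype.card L := Fintype.card_pos_iff.2 ⟨⟨x, hmi x⟩⟩
    omega
  have hR : Fintype.card R = (Fintype.card R - 1) + 1 := by
    have : 0 < Fintype.card R := Fintype.card_pos_iff.2 ⟨⟨x, hmi x⟩⟩
    omega
  refine ⟨_, _, f.trans ((Fintype.equivFinOfCardEq hL).prodCongr
    (Fintype.equivFinOfCardEq hR)), fun a b => ?_⟩
  have h1 : (f (mul a b)).1 = (f a).1 := Subtype.ext (by simp only [f, Equiv.coe_fn_mk, hma, abc])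
  have h2 : (f (mul a b)).2 = (f b).2 := Subtype.ext (by simp only [f, Equiv.coe_fn_mk, abc])
  simp [Equiv.trans_apply, Equiv.prodCongr_apply, Prod.map, h1, h2]

def glueEquiv (m n p q : ℕ) :
    (Fin (m + 1) × Fin (n + 1)) × (Fin (p + 1) × Fin (q + 1)) ≃
      ∀ k : Fin 4, Fin ((![m, n, p, q] : Fin 4 → ℕ) k + 1) where
  toFun x := fun k => match k with
    | 0 => x.1.1
    | 1 => x.1.2
    | 2 => x.2.1
    | 3 => x.2.2
  invFun g := ((g 0, g 1), (g 2, g 3))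
  left_inv _ := rfl
  right_inv g := by
    funext k
    fin_cases k <;> rfl

/-- Theorem 1, case of two factors: the genetic product of two finite genetic semigroups is
isomorphic to a splicing 3-groupoid `GA(3; d₁, d₂, d₃, d₄)`. -/
theorem genetic_product_of_genetic_semigroups_is_splicing
    {A B : Type*} [Fintype A] [Nonempty A] [Fintype B] [Nonempty B]
    (mul : A → A → A) (star : B → B → B)
    (hma : ∀ a b c, mul (mul a b) c = mul a (mul b c))
    (hmi : ∀ a, mul a a = a)
    (hmn : ∀ a b, mul a b = mul b a → a = b)
    (hsa : ∀ a b c, star (star a b) c = star a (star b c))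
    (hsi : ∀ a, star a a = a)
    (hsn : ∀ a b, star a b = star b a → a = b) :
    ∃ (d : Fin 4 → ℕ) (e : A × B ≃ ∀ k : Fin 4, Fin (d k + 1)),
      (∀ p q : A × B, e (gOp1 mul p q) = splice 3 d 0 (e p) (e q)) ∧
      (∀ p q : A × B, e (gOp2 p q) = splice 3 d 1 (e p) (e q)) ∧
      (∀ p q : A × B, e (gOp3 star p q) = splice 3 d 2 (e p) (e q)) := by
  obtain ⟨m, n, e, he⟩ := rect_aux mul hma hmi hmn
  obtain ⟨p, q, f, hf⟩ := rect_aux star hsa hsi hsn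
  refine ⟨![m, n, p, q], (e.prodCongr f).trans (glueEquiv m n p q), ?_, ?_, ?_⟩
  · rintro ⟨a, b⟩ ⟨c, d⟩
    funext k
    fin_cases k <;> simp [gOp1, splice, glueEquiv, he]
  · rintro ⟨a, b⟩ ⟨c, d⟩
    funext k
    fin_cases k <;> simp [gOp2, splice, glueEquiv]
  · rintro ⟨a, b⟩ ⟨c, d⟩
    funext k
    fin_cases k <;> simp [gOp3, splice, glueEquiv, hf]
end

section
/- The class of rectangular bands is the variety of genetic semigroups: a binary operation · on a set M satisfies the two identities ∀ a b c, (a·b)·c = a·(b·c) and ∀ a b, (a·b)·a = a if and only if · is associative, idempotent (a·a = a for all a), and nowhere commutative (a·b = b·a implies a = b). -/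
/-- The rectangular-band identities characterize genetic semigroups: a binary operation
satisfies `(ab)c = a(bc)` and `(ab)a = a` iff it is associative, idempotent and nowhere
commutative. -/
theorem rectangular_band_iff_genetic_semigroup {M : Type*} (mul : M → M → M) :
    ((∀ a b c, mul (mul a b) c = mul a (mul b c)) ∧ (∀ a b, mul (mul a b) a = a)) ↔
    ((∀ a b c, mul (mul a b) c = mul a (mul b c)) ∧ (∀ a, mul a a = a) ∧
      (∀ a b, mul a b = mul b a → a = b)) := by
  constructor
  · rintro ⟨ha, hr⟩
    have hi : ∀ a, mul a a = a := by
      intro a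
      have h1 := hr a (mul a a)
      rw [← ha a a a, hr a a] at h1
      exact h1
    refine ⟨ha, hi, fun a b h => ?_⟩
    have h1 : a = mul b a := by
      have := hr a b
      rw [h, ha, hi] at this
      exact this.symm
    have h2 : b = mul a b := by
      have := hr b a
      rw [← h, ha, hi] at this
      exact this.symm
    rw [h1, ← h, ← h2]
  · rintro ⟨ha, hi, hn⟩
    refine ⟨ha, fun a b => ?_⟩
    apply hn
    rw [ha (mul a b) a a, hi, ha a b a, ← ha a a, hi]
end

section
/- There is only one associative three-element genetic groupoid up to isomorphism and anti-isomorphism: if · is an associative, idempotent, nowhere commutative binary operation on a set with exactly three elements, then either x·y = x for all x, y, or x·y = y for all x, y. -/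
/-- There is only one associative three-element genetic groupoid up to isomorphism and
anti-isomorphism: an associative, idempotent, nowhere commutative operation on a
three-element set is either the left projection or the right projection. -/
theorem three_element_genetic_semigroup {G : Type*} [Fintype G]
    (hcard : Fintype.card G = 3) (m : G → G → G)
    (hassoc : ∀ a b c, m (m a b) c = m a (m b c))
    (hidem : ∀ a, m a a = a)
    (hnc : ∀ a b, m a b = m b a → a = b) :
    (∀ x y, m x y = x) ∨ (∀ x y, m x y = y) := by
  classical
  have h1 : ∀ x y, m x (m y x) = x := by
    intro x y
    apply hnc
    rw [← hassoc x x, hidem, hassoc, hassoc, hidem]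
  have h2 : ∀ x y, m x y = x ∨ m x y = y := by
    intro x y
    by_contra! h
    obtain ⟨hx, hy⟩ := h
    have hxy : x ≠ y := by
      rintro rfl
      exact hx (hidem x)
    have e1 : m y x ≠ x := by
      intro e
      apply hy
      have := h1 y x
      rwa [← hassoc, e] at this
    have e2 : m y x ≠ y := by
      intro e
      apply hx
      have := h1 x y
      rwa [e] at this
    have e3 : m x y ≠ m y x := fun e => hxy (hnc _ _ e)
    have hc : ({x, y, m x y, m y x} : Finset G).card = 4 := by
      rw [Finset.card_insert_of_notMem, Finset.card_insert_of_notMem, Finset.card_pair e3]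
      · simp [hy.symm, e2.symm]
      · simp [hxy, hx.symm, e1.symm]
    have := Finset.card_le_univ ({x, y, m x y, m y x} : Finset G)
    omega
  have h3 : ∀ a b c, a ≠ b → m a b = a → m a c = a := by
    intro a b c hab e
    by_contra hc
    have e1 : m a c = c := (h2 a c).resolve_left hc
    have e2 : m c b = a := by
      have h : m a (m c b) = m c b := by rw [← hassoc, e1]
      have h' := h1 a c
      have : m a (m c b) = m a b := by
        conv_rhs => rw [← h1 a c]
        rw [hassoc, hassoc, e, ← hassoc, e1]
        grind
      rw [← h, this, e]
    grind
  by_cases h : ∃ a b, a ≠ b ∧ m a b = a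
  · obtain ⟨a, b, hab, e⟩ := h
    left
    have ha : ∀ c, m a c = a := fun c => h3 a b c hab e
    intro x y
    by_cases hx : x = a
    · rw [hx, ha]
    · refine h3 x a y hx ?_
      have := h1 x a
      rwa [ha] at this
  · right
    push Not at h
    intro x y
    by_cases hx : x = y
    · rw [hx, hidem]
    · exact (h2 x y).resolve_left (h x y hx)
end
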